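/- Let 𝒫 = (α, w) be a k-coin distribution (k ≥ 2) with separation ζ and minimum weight w_min, and let H_{k+1} be its (k+1)×(k+1) Hankel matrix. Then the second smallest eigenvalue of H_{k+1} satisfies λ₂(H_{k+1}) > w_min · (ζ/16)^{2k−2}. -/

import Mathlib

open Matrix

/-- The eigenvalues of a real symmetric matrix, sorted in increasing order
(with multiplicity), as a list. -/
noncomputable def sortedEigenvalues {n : ℕ} {A : Matrix (Fin n) (Fin n) ℝ}
    (hA : A.IsHermitian) : List ℝ :=
  (Finset.univ.val.map hA.eigenvalues).sort (· ≤ ·)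

lemma aux_two {n : ℕ} (hn : 2 ≤ n) (f : Fin n → ℝ) (c : ℝ)
    (h : ((Finset.univ.val.map f).sort (· ≤ ·))[1]! ≤ c) :
    ∃ i j, i ≠ j ∧ f i ≤ c ∧ f j ≤ c := by
  have hs : (Finset.univ.val.map f).sort (· ≤ ·) |>.Pairwise (· ≤ ·) :=
    Multiset.pairwise_sort _ _
  have he : (((Finset.univ.val.map f).sort (· ≤ ·) : List ℝ) : Multiset ℝ)
    = Finset.univ.val.map f := Multiset.sort_eq _ _
  have hl : ((Finset.univ.val.map f).sort (· ≤ ·)).length = n := by simp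
  generalize (Finset.univ.val.map f).sort (· ≤ ·) = l at *
  match l, hl with
  | [], hl => simp at hl; omega
  | [_], hl => simp at hl; omega
  | a :: b :: t, hl =>
    have hb : b ≤ c := by simpa using h
    have ha : a ≤ c := by
      have : a ≤ b := by
        rw [List.pairwise_cons] at hs
        exact hs.1 b (by simp)
      linarith
    have h2 : 2 ≤ Multiset.countP (· ≤ c) (Finset.univ.val.map f) := by
      rw [← he]
      simp [ha, hb]
    rw [Multiset.countP_map] at h2
    have h3 : 1 < (Finset.univ.filter (fun i => f i ≤ c)).card := by
      exact h2
    obtain ⟨i, hi, j, hj, hij⟩ := Finset.one_lt_card.1 h3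
    simp at hi hj
    exact ⟨i, j, hij, hi, hj⟩

open Polynomial in
lemma aux_step (n : ℕ) (p : ℝ[X]) (a : ℝ) :
    ∑ i ∈ Finset.range n, |(p * (X - C a)).coeff i|
      ≤ (1 + |a|) * ∑ i ∈ Finset.range n, |p.coeff i| := by
  have h1 : ∑ i ∈ Finset.range n, |(p * X).coeff i| ≤ ∑ i ∈ Finset.range n, |p.coeff i| := by
    cases n with
    | zero => simp
    | succ n =>
      rw [Finset.sum_range_succ', Finset.sum_range_succ]
      simp [coeff_mul_X]
  calc _ ≤ ∑ i ∈ Finset.range n, (|(p * X).coeff i| + |a| * |p.coeff i|) := by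
        refine Finset.sum_le_sum fun i _ => ?_
        rw [mul_sub, coeff_sub, coeff_mul_C, mul_comm |a|, ← abs_mul]
        exact abs_sub _ _
    _ ≤ _ := by
        rw [Finset.sum_add_distrib, ← Finset.mul_sum]
        linarith

open Polynomial in
lemma aux_prod {ι : Type*} [DecidableEq ι] (n : ℕ) (v : ι → ℝ) (x M : ℝ) (hM : 0 ≤ M)
    (s : Finset ι) (h : ∀ j ∈ s, |(x - v j)⁻¹| * (1 + |v j|) ≤ M) :
    ∑ i ∈ Finset.range n, |(∏ j ∈ s, Lagrange.basisDivisor x (v j)).coeff i|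
      ≤ M ^ s.card := by
  induction s using Finset.induction_on with
  | empty =>
    simp only [Finset.prod_empty, coeff_one, Finset.card_empty, pow_zero]
    cases n with
    | zero => simp
    | succ n => rw [Finset.sum_range_succ']; simp
  | insert j s hj ih =>
    rw [Finset.prod_insert hj, Finset.card_insert_of_notMem hj, pow_succ']
    have ih' := ih (fun i hi => h i (Finset.mem_insert_of_mem hi))
    have hjM := h j (Finset.mem_insert_self _ _)
    set p := ∏ j ∈ s, Lagrange.basisDivisor x (v j)
    have e : Lagrange.basisDivisor x (v j) * p = C (x - v j)⁻¹ * (p * (X - C (v j))) := by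
      rw [Lagrange.basisDivisor]; ring
    rw [e]
    simp only [coeff_C_mul, abs_mul]
    rw [← Finset.mul_sum]
    calc _ ≤ |(x - v j)⁻¹| * ((1 + |v j|) * ∑ i ∈ Finset.range n, |p.coeff i|) :=
          mul_le_mul_of_nonneg_left (aux_step n p (v j)) (abs_nonneg _)
      _ = (|(x - v j)⁻¹| * (1 + |v j|)) * ∑ i ∈ Finset.range n, |p.coeff i| := by ring
      _ ≤ _ := mul_le_mul hjM ih' (Finset.sum_nonneg fun _ _ => abs_nonneg _) hM

open Polynomial in
lemma aux_coeff (k : ℕ) (α : Fin k → ℝ) (hα : ∀ j, α j ∈ Set.Icc (0 : ℝ) 1)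
    (ζ : ℝ) (hζ : 0 < ζ) (hsep : ∀ i j, i ≠ j → ζ ≤ |α i - α j|) (y : Fin k → ℝ) :
    ∑ i, y i ^ 2 ≤ (k * (2 / ζ) ^ (2 * (k - 1))) * ∑ l, (∑ i, y i * α l ^ (i : ℕ)) ^ 2 := by
  classical
  set p : ℝ[X] := ∑ i : Fin k, C (y i) * X ^ (i : ℕ) with hp
  have hcoef : ∀ i : Fin k, p.coeff i = y i := by
    intro i
    simp [hp, finsetSum_coeff, coeff_X_pow, Fin.val_inj]
  have hdeg : p.degree < (Finset.univ : Finset (Fin k)).card := by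
    rw [degree_lt_iff_coeff_zero]
    intro m hm
    simp at hm
    rw [hp, finsetSum_coeff]
    refine Finset.sum_eq_zero fun i _ => ?_
    rw [coeff_C_mul, coeff_X_pow, if_neg (by have := i.2; omega), mul_zero]
  have hev : ∀ l, p.eval (α l) = ∑ i, y i * α l ^ (i : ℕ) := by
    intro l; simp [hp, eval_finsetSum]
  have hinj : Set.InjOn α (Finset.univ : Finset (Fin k)) := by
    intro i _ j _ hij
    by_contra hne
    have := hsep i j hne
    rw [hij] at this
    simp at this; linarith
  have hL := Lagrange.eq_interpolate (s := Finset.univ) (v := α) hinj hdeg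
  set B := fun l => Lagrange.basis Finset.univ α l with hB
  have hy : ∀ i : Fin k, y i = ∑ l, p.eval (α l) * (B l).coeff i := by
    intro i
    rw [← hcoef i]
    conv_lhs => rw [hL]
    rw [Lagrange.interpolate_apply, finsetSum_coeff]
    simp [hB]
  have hBn : ∀ l, ∑ i : Fin k, (B l).coeff i ^ 2 ≤ (2 / ζ) ^ (2 * (k - 1)) := by
    intro l
    have h1 : ∑ i ∈ Finset.range k, |(B l).coeff i| ≤ (2 / ζ) ^ (k - 1) := by
      have := aux_prod k α (α l) (2 / ζ) (by positivity) (Finset.univ.erase l) (by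
        intro j hj
        have hjl : l ≠ j := (Finset.ne_of_mem_erase hj).symm
        have h2 := hsep l j hjl
        rw [abs_inv, inv_mul_eq_div]
        have h3 := hα j
        rw [abs_of_nonneg h3.1]
        exact div_le_div₀ (by norm_num) (by linarith [h3.2]) hζ h2)
      simpa [hB, Lagrange.basis] using this
    rw [← Fin.sum_univ_eq_sum_range (fun i => |(B l).coeff i|)] at h1
    calc _ = ∑ i : Fin k, |(B l).coeff i| ^ 2 := by simp
      _ ≤ (∑ i : Fin k, |(B l).coeff i|) ^ 2 :=
        Finset.sum_sq_le_sq_sum_of_nonneg fun _ _ => abs_nonneg _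
      _ ≤ ((2 / ζ) ^ (k - 1)) ^ 2 :=
        pow_le_pow_left₀ (Finset.sum_nonneg fun _ _ => abs_nonneg _) h1 2
      _ = _ := by rw [← pow_mul, mul_comm]
  calc ∑ i, y i ^ 2 ≤ ∑ i : Fin k, (∑ l, p.eval (α l) ^ 2) * ∑ l, (B l).coeff i ^ 2 := by
        refine Finset.sum_le_sum fun i _ => ?_
        rw [hy i]
        exact Finset.sum_mul_sq_le_sq_mul_sq _ _ _
    _ = (∑ l, ∑ i : Fin k, (B l).coeff i ^ 2) * ∑ l, p.eval (α l) ^ 2 := by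
        rw [← Finset.mul_sum, Finset.sum_comm, mul_comm]
    _ ≤ (∑ l : Fin k, (2 / ζ) ^ (2 * (k - 1))) * ∑ l, p.eval (α l) ^ 2 := by
        refine mul_le_mul_of_nonneg_right (Finset.sum_le_sum fun l _ => hBn l) ?_
        positivity
    _ = _ := by simp [hev]

lemma aux_eig {n : ℕ} {H : Matrix (Fin (n+1)) (Fin (n+1)) ℝ} (hH : H.IsHermitian) (c : ℝ)
    (i j : Fin (n+1)) (hij : i ≠ j) (hi : hH.eigenvalues i ≤ c) (hj : hH.eigenvalues j ≤ c) :
    ∃ x : Fin (n+1) → ℝ, x (Fin.last n) = 0 ∧ 0 < x ⬝ᵥ x ∧ x ⬝ᵥ (H *ᵥ x) ≤ c * (x ⬝ᵥ x) := by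
  have hu := hH.mulVec_eigenvectorBasis i
  have hv := hH.mulVec_eigenvectorBasis j
  have huu : (hH.eigenvectorBasis i).ofLp ⬝ᵥ (hH.eigenvectorBasis i).ofLp = 1 := by
    have := hH.eigenvectorBasis.inner_eq_one i
    rw [EuclideanSpace.inner_eq_star_dotProduct] at this
    simpa only [star_trivial] using this
  have hvv : (hH.eigenvectorBasis j).ofLp ⬝ᵥ (hH.eigenvectorBasis j).ofLp = 1 := by
    have := hH.eigenvectorBasis.inner_eq_one j
    rw [EuclideanSpace.inner_eq_star_dotProduct] at this
    simpa only [star_trivial] using this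
  have huv : (hH.eigenvectorBasis i).ofLp ⬝ᵥ (hH.eigenvectorBasis j).ofLp = 0 := by
    have := hH.eigenvectorBasis.inner_eq_zero hij.symm
    simpa [EuclideanSpace.inner_eq_star_dotProduct] using this
  generalize (hH.eigenvectorBasis i).ofLp = u at *
  generalize (hH.eigenvectorBasis j).ofLp = v at *
  have hvu : v ⬝ᵥ u = 0 := by rw [dotProduct_comm]; exact huv
  have key : ∀ a b : ℝ, (a • u + b • v) ⬝ᵥ (a • u + b • v) = a ^ 2 + b ^ 2 := by
    intro a b
    simp [huu, hvv, huv, hvu]; ring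
  have key2 : ∀ a b : ℝ, (a • u + b • v) ⬝ᵥ (H *ᵥ (a • u + b • v))
      = a ^ 2 * hH.eigenvalues i + b ^ 2 * hH.eigenvalues j := by
    intro a b
    rw [mulVec_add, mulVec_smul, mulVec_smul, hu, hv]
    simp [huu, hvv, huv, hvu]; ring
  have key3 : ∀ a b : ℝ, (a • u + b • v) ⬝ᵥ (H *ᵥ (a • u + b • v)) ≤
      c * ((a • u + b • v) ⬝ᵥ (a • u + b • v)) := by
    intro a b
    rw [key, key2]
    nlinarith [mul_le_mul_of_nonneg_left hi (sq_nonneg a),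
      mul_le_mul_of_nonneg_left hj (sq_nonneg b)]
  by_cases h0 : u (Fin.last n) = 0
  · refine ⟨(1:ℝ) • u + (0:ℝ) • v, by simp [h0], ?_, key3 _ _⟩
    rw [key]; norm_num
  · refine ⟨v (Fin.last n) • u + (-u (Fin.last n)) • v, ?_, ?_, key3 _ _⟩
    · simp; ring
    · rw [key]; have := sq_nonneg (v (Fin.last n)); have := sq_pos_of_ne_zero h0; nlinarith


/-- For a `k`-coin distribution (`k ≥ 2`) with separation `ζ` and
minimum weight `w_min`, the second smallest eigenvalue of its `(k+1) × (k+1)` Hankel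
matrix satisfies `λ₂(H_{k+1}) > w_min · (ζ/16)^(2k-2)`. -/
theorem hankel_second_eigenvalue_lower_bound
    (k : ℕ) (hk : 2 ≤ k)
    (α : Fin k → ℝ) (hα : ∀ j, α j ∈ Set.Icc (0 : ℝ) 1)
    (w : Fin k → ℝ) (hw : ∀ j, 0 < w j) (hsum : ∑ j, w j = 1)
    (ζ wmin : ℝ) (hζ : 0 < ζ)
    (hsep : ∀ i j, i ≠ j → ζ ≤ |α i - α j|)
    (hwmin0 : 0 < wmin) (hwmin : ∀ j, wmin ≤ w j)
    (H : Matrix (Fin (k + 1)) (Fin (k + 1)) ℝ)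
    (hH : ∀ i j, H i j = ∑ l, w l * α l ^ ((i : ℕ) + (j : ℕ)))
    (hHerm : H.IsHermitian) :
    wmin * (ζ / 16) ^ (2 * k - 2) < (sortedEigenvalues hHerm)[1]! := by
  by_contra hcon
  rw [not_lt] at hcon
  obtain ⟨i, j, hij, hi, hj⟩ := aux_two (by omega) _ _ hcon
  obtain ⟨x, hx0, hxp, hxH⟩ := aux_eig hHerm _ i j hij hi hj
  set y : Fin k → ℝ := fun i => x i.castSucc with hy
  have hxx : x ⬝ᵥ x = ∑ i, y i ^ 2 := by
    rw [dotProduct, Fin.sum_univ_castSucc, hx0]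
    simp [hy, sq]
  have hpol : ∀ l, ∑ i, x i * α l ^ (i : ℕ) = ∑ i, y i * α l ^ (i : ℕ) := by
    intro l
    rw [Fin.sum_univ_castSucc, hx0]
    simp [hy]
  have hquad : x ⬝ᵥ (H *ᵥ x) = ∑ l, w l * (∑ i, y i * α l ^ (i : ℕ)) ^ 2 := by
    simp only [← hpol, dotProduct, mulVec, hH, sq, Finset.sum_mul, Finset.mul_sum]
    rw [Finset.sum_comm]
    conv_rhs => rw [Finset.sum_comm]
    rw [Finset.sum_comm]
    refine Finset.sum_congr rfl fun a _ => ?_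
    rw [Finset.sum_comm]
    refine Finset.sum_congr rfl fun b _ => ?_
    refine Finset.sum_congr rfl fun d _ => ?_
    ring
  have hlow : wmin * ∑ l, (∑ i, y i * α l ^ (i : ℕ)) ^ 2 ≤ x ⬝ᵥ (H *ᵥ x) := by
    rw [hquad, Finset.mul_sum]
    exact Finset.sum_le_sum fun l _ => mul_le_mul_of_nonneg_right (hwmin l) (sq_nonneg _)
  have hA := aux_coeff k α hα ζ hζ hsep y
  rw [← hxx] at hA
  set S := ∑ l, (∑ i, y i * α l ^ (i : ℕ)) ^ 2 with hS
  have hS1 : S ≤ (ζ / 16) ^ (2 * k - 2) * (x ⬝ᵥ x) := by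
    have : wmin * S ≤ wmin * ((ζ / 16) ^ (2 * k - 2) * (x ⬝ᵥ x)) := by
      rw [← mul_assoc]; exact hlow.trans hxH
    exact le_of_mul_le_mul_left this hwmin0
  have hc : (k * (2 / ζ) ^ (2 * (k - 1))) * (ζ / 16) ^ (2 * k - 2) < 1 := by
    have e : 2 * k - 2 = 2 * (k - 1) := by omega
    rw [e, mul_assoc, ← mul_pow]
    have e2 : 2 / ζ * (ζ / 16) = 1 / 8 := by field_simp; norm_num
    rw [e2, pow_mul]
    obtain ⟨m, rfl⟩ : ∃ m, k = m + 1 := ⟨k - 1, by omega⟩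
    have hm : m + 1 ≤ 2 ^ m := Nat.lt_two_pow_self
    have hm' : ((m + 1 : ℕ) : ℝ) ≤ 2 ^ m := by exact_mod_cast hm
    simp only [Nat.add_sub_cancel]
    calc _ ≤ (2:ℝ) ^ m * ((1 / 8) ^ 2) ^ m :=
          mul_le_mul_of_nonneg_right hm' (by positivity)
      _ = (1 / 32) ^ m := by rw [← mul_pow]; norm_num
      _ < 1 := pow_lt_one₀ (by norm_num) (by norm_num) (by omega)
  have hK : (0:ℝ) ≤ k * (2 / ζ) ^ (2 * (k - 1)) := by positivity
  nlinarith [mul_le_mul_of_nonneg_left hS1 hK, mul_lt_mul_of_pos_right hc hxp]
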